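/- Fix a real $q>1$ and $L>0$, and let $v^*$ be the unique positive real with $\bm{L}(v^*)=L/2$. For $0 < v_l \le v_l'$ and any real $s$ with $|s - L/2| < \bm{L}(v_l')$, one has $W_{v_l}(|s-L/2|) \le W_{v_l'}(|s-L/2|)$. Moreover, if $(v_n)$ is a nondecreasing sequence in $(0, v^*]$ with $v_n \to v^*$, then for every $s$ with $|s-L/2| < \bm{L}(v^*)$ the values $W_{v_n}(|s-L/2|)$ form a nondecreasing sequence converging to $W_{v^*}(|s-L/2|)$. -/

import Mathlib

open Set Filter MeasureTheory

/-- `I(q) = ∫_1^∞ (u^(q+1) - 1)^(-1/2) du` (Lebesgue integral over `Ioi 1`). -/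
noncomputable def Iq (q : ℝ) : ℝ :=
  ∫ u in Set.Ioi (1 : ℝ), (u ^ (q + 1) - 1) ^ (-(1 / 2) : ℝ)

/-- `x(v, v_l) = v_l^((1-q)/2) ((q+1)/4)^(1/2) ∫_1^{v/v_l} (u^(q+1)-1)^(-1/2) du`. -/
noncomputable def xfun (q v vl : ℝ) : ℝ :=
  vl ^ ((1 - q) / 2 : ℝ) * ((q + 1) / 4) ^ ((1 : ℝ) / 2) *
    ∫ u in Set.Ioc (1 : ℝ) (v / vl), (u ^ (q + 1) - 1) ^ (-(1 / 2) : ℝ)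

/-- `L(v_l) = v_l^((1-q)/2) ((q+1)/4)^(1/2) I(q)`. -/
noncomputable def Lfun (q vl : ℝ) : ℝ :=
  vl ^ ((1 - q) / 2 : ℝ) * ((q + 1) / 4) ^ ((1 : ℝ) / 2) * Iq q

/-- The integrand `(u^(q+1) - 1)^(-1/2)` is integrable near its singularity at `1`. -/
lemma integrableOn_Ioc_rpow_sub_one {q : ℝ} (hq : 0 < q) (b : ℝ) :
    IntegrableOn (fun u : ℝ => (u ^ (q + 1) - 1) ^ (-(1 / 2) : ℝ)) (Ioc 1 b) := by
  rcases lt_or_ge b 1 with hb | hb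
  · simp [Ioc_eq_empty_of_le hb.le]
  have h : IntegrableOn (fun u : ℝ => (u - 1) ^ (-(1 / 2) : ℝ)) (Ioc 1 b) := by
    have h1 := (intervalIntegral.intervalIntegrable_rpow' (a := 0) (b := b - 1)
      (r := (-(1 / 2) : ℝ)) (by norm_num)).comp_sub_right 1
    simpa [intervalIntegrable_iff_integrableOn_Ioc_of_le hb] using h1
  refine Integrable.mono' h (Measurable.aestronglyMeasurable (by fun_prop)) ?_
  filter_upwards [ae_restrict_mem measurableSet_Ioc] with u hu
  have hu1 : u ≤ u ^ (q + 1) := by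
    simpa using Real.rpow_le_rpow_of_exponent_le hu.1.le (by linarith : (1 : ℝ) ≤ q + 1)
  have hu0 := hu.1
  rw [Real.norm_of_nonneg (Real.rpow_nonneg (by linarith) _)]
  exact Real.rpow_le_rpow_of_nonpos (by linarith) (by linarith) (by norm_num)

lemma rpow_sub_one_rpow_nonneg {q u : ℝ} (hq : 0 < q) (hu : 1 < u) :
    0 ≤ (u ^ (q + 1) - 1) ^ (-(1 / 2) : ℝ) :=
  Real.rpow_nonneg (sub_nonneg.2 (Real.one_le_rpow hu.le (by linarith))) _

lemma setIntegral_Ioc_rpow_sub_one_mono {q : ℝ} (hq : 0 < q) :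
    Monotone fun b : ℝ => ∫ u in Ioc (1 : ℝ) b, (u ^ (q + 1) - 1) ^ (-(1 / 2) : ℝ) := by
  intro a b hab
  refine setIntegral_mono_set (integrableOn_Ioc_rpow_sub_one hq b) ?_
    (Ioc_subset_Ioc_right hab).eventuallyLE
  filter_upwards [ae_restrict_mem measurableSet_Ioc] with u hu
  exact rpow_sub_one_rpow_nonneg hq hu.1

lemma xfun_mono_left {q vl : ℝ} (hq : 0 < q) (hvl : 0 < vl) :
    Monotone fun v => xfun q v vl := by
  intro a b hab
  refine mul_le_mul_of_nonneg_left (setIntegral_Ioc_rpow_sub_one_mono hq ?_) (by positivity)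
  gcongr

lemma xfun_anti_right {q v vl vl' : ℝ} (hq : 1 < q) (hv : 0 ≤ v) (hvl : 0 < vl)
    (h : vl ≤ vl') : xfun q v vl' ≤ xfun q v vl := by
  have hvl' := hvl.trans_le h
  unfold xfun
  refine mul_le_mul (mul_le_mul_of_nonneg_right
    (Real.rpow_le_rpow_of_nonpos hvl h (by linarith)) (by positivity))
    (setIntegral_Ioc_rpow_sub_one_mono (by linarith) (by gcongr)) ?_ (by positivity)
  exact setIntegral_nonneg measurableSet_Ioc
    fun u hu => rpow_sub_one_rpow_nonneg (by linarith) hu.1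

lemma Lfun_anti {q vl vl' : ℝ} (hq : 1 < q) (hvl : 0 < vl) (h : vl ≤ vl') :
    Lfun q vl' ≤ Lfun q vl := by
  unfold Lfun Iq
  refine mul_le_mul_of_nonneg_right (mul_le_mul_of_nonneg_right
    (Real.rpow_le_rpow_of_nonpos hvl h (by linarith)) (by positivity)) ?_
  exact setIntegral_nonneg measurableSet_Ioi
    fun u hu => rpow_sub_one_rpow_nonneg (by linarith) hu

/-- Left continuity of `x(a, ·)`. -/
lemma continuousWithinAt_xfun_right {q a c : ℝ} (hq : 0 < q) (hc : 0 < c) (hca : c ≤ a) :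
    ContinuousWithinAt (fun vl => xfun q a vl) (Ioc 0 c) c := by
  have hdiv : ContinuousWithinAt (fun vl => a / vl) (Ioc 0 c) c :=
    (continuousAt_const.div continuousAt_id hc.ne').continuousWithinAt
  have h1 : 1 ≤ a / c := (one_le_div hc).2 hca
  have hint : ContinuousWithinAt
      (fun b : ℝ => ∫ u in Ioc (1 : ℝ) b, (u ^ (q + 1) - 1) ^ (-(1 / 2) : ℝ)) (Ici 1) (a / c) := by
    have h2 := intervalIntegral.continuousOn_primitive (μ := volume) (a := 1) (b := a / c + 1)
      ((integrableOn_Icc_iff_integrableOn_Ioc).2 (integrableOn_Ioc_rpow_sub_one hq _))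
      (a / c) ⟨h1, by linarith⟩
    refine h2.mono_of_mem_nhdsWithin ?_
    rw [← Ici_inter_Iic]
    exact inter_mem_nhdsWithin _ (Iic_mem_nhds (by linarith))
  have hmaps : MapsTo (fun vl => a / vl) (Ioc 0 c) (Ici 1) := fun vl hvl =>
    (one_le_div hvl.1).2 (hvl.2.trans hca)
  have hpow : ContinuousWithinAt (fun vl : ℝ => vl ^ ((1 - q) / 2 : ℝ)) (Ioc 0 c) c :=
    (Real.continuousAt_rpow_const c _ (Or.inl hc.ne')).continuousWithinAt
  exact (hpow.mul continuousWithinAt_const).mul (hint.comp hdiv hmaps)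

/-- monotonicity of `v_l ↦ W_{v_l}(|s - L/2|)` and convergence
`W_{v_n}(|s - L/2|) ↗ W_{v*}(|s - L/2|)` for nondecreasing `v_n ↗ v*` in `(0, v*]`,
where `W vl` denotes the inverse of `v ↦ x(v, vl)` and `v*` is the unique positive
solution of `L(v*) = L/2`. -/
theorem stmt8 (q L vstar : ℝ) (hq : 1 < q) (hL : 0 < L)
    (hvstar_pos : 0 < vstar) (hvstar_eq : Lfun q vstar = L / 2)
    (W : ℝ → ℝ → ℝ)
    (hW1 : ∀ vl : ℝ, 0 < vl → ∀ v ∈ Set.Ici vl, W vl (xfun q v vl) = v)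
    (hW2 : ∀ vl : ℝ, 0 < vl →
      ∀ s ∈ Set.Ico 0 (Lfun q vl), W vl s ∈ Set.Ici vl ∧ xfun q (W vl s) vl = s) :
    (∀ vl vl' : ℝ, 0 < vl → vl ≤ vl' → ∀ s : ℝ, |s - L / 2| < Lfun q vl' →
      W vl |s - L / 2| ≤ W vl' |s - L / 2|) ∧
    (∀ v : ℕ → ℝ, Monotone v → (∀ n, v n ∈ Set.Ioc 0 vstar) →
      Tendsto v atTop (nhds vstar) →
      ∀ s : ℝ, |s - L / 2| < Lfun q vstar →
        Monotone (fun n => W (v n) |s - L / 2|) ∧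
        Tendsto (fun n => W (v n) |s - L / 2|) atTop (nhds (W vstar |s - L / 2|))) := by
  have hq0 : 0 < q := by linarith
  have hmono : ∀ vl vl' : ℝ, 0 < vl → vl ≤ vl' → ∀ t ∈ Ico 0 (Lfun q vl'),
      W vl t ≤ W vl' t := by
    intro vl vl' hvl h t ht
    obtain ⟨hw', hx'⟩ := hW2 vl' (hvl.trans_le h) t ht
    obtain ⟨-, hx⟩ := hW2 vl hvl t ⟨ht.1, ht.2.trans_le (Lfun_anti hq hvl h)⟩
    have hw'vl : vl ≤ W vl' t := h.trans hw'
    by_contra! hlt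
    have h1 : xfun q (W vl' t) vl = t := by
      refine le_antisymm ?_ ?_
      · exact (xfun_mono_left hq0 hvl hlt.le).trans_eq hx
      · exact hx'.symm.trans_le (xfun_anti_right hq (hvl.le.trans hw'vl) hvl h)
    have h2 := hW1 vl hvl _ hw'vl
    rw [h1] at h2
    exact hlt.ne' h2
  refine ⟨fun vl vl' hvl h s hs => hmono vl vl' hvl h _ ⟨abs_nonneg _, hs⟩, ?_⟩
  intro v hv hv_mem hv_lim s hs
  generalize ht' : |s - L / 2| = t at hs ⊢
  have ht0 : 0 ≤ t := ht' ▸ abs_nonneg _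
  have ht : ∀ n, t ∈ Ico 0 (Lfun q (v n)) := fun n =>
    ⟨ht0, hs.trans_le (Lfun_anti hq (hv_mem n).1 (hv_mem n).2)⟩
  refine ⟨fun m n hmn => hmono _ _ (hv_mem m).1 (hv hmn) _ (ht n), ?_⟩
  refine tendsto_order.2 ⟨fun a ha => ?_, fun a ha => Eventually.of_forall fun n =>
    (hmono _ _ (hv_mem n).1 (hv_mem n).2 t ⟨ht0, hs⟩).trans_lt ha⟩
  rcases lt_or_ge a vstar with hav | hav
  · filter_upwards [hv_lim.eventually_const_lt hav] with n hn
    exact hn.trans_le (hW2 _ (hv_mem n).1 t (ht n)).1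
  · obtain ⟨-, hx⟩ := hW2 vstar hvstar_pos t ⟨ht0, hs⟩
    have hlt : xfun q a vstar < t := by
      refine lt_of_le_of_ne ((xfun_mono_left hq0 hvstar_pos ha.le).trans_eq hx) fun heq => ?_
      have h2 := hW1 vstar hvstar_pos a hav
      rw [heq] at h2
      exact ha.ne' h2
    have hlim : Tendsto (fun n => xfun q a (v n)) atTop (nhds (xfun q a vstar)) :=
      (continuousWithinAt_xfun_right hq0 hvstar_pos hav).tendsto.comp
        (tendsto_nhdsWithin_iff.2 ⟨hv_lim, Eventually.of_forall hv_mem⟩)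
    filter_upwards [hlim.eventually_lt_const hlt] with n hn
    rw [← (hW2 _ (hv_mem n).1 t (ht n)).2] at hn
    exact (xfun_mono_left hq0 (hv_mem n).1).reflect_lt hn
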